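/- arXiv:1905.07050 — 6 statements merged into one kernel-verified Lean document; each statement's English description precedes it below -/
import Mathlib

section
/- Let $CF_1(x_1,x_2,x_3,x_4,\gamma) = (1-\gamma)^2(1-\tfrac{2}{3}x_1x_2) + 2\gamma(1-\gamma)(1-x_1+\tfrac{1}{3}x_1x_3) + \gamma^2(1-\tfrac{2}{3}x_1x_4)$ and $CF_2(x_1,x_2,x_3,x_4,\gamma) = (1-\gamma)^2\tfrac{1}{3}x_1x_2 + \gamma(1-\gamma)x_1(1-\tfrac{1}{3}x_3) + \gamma^2\tfrac{1}{3}x_1x_4$. If $0 \le x_1,x_2,x_3,x_4 \le 1$, $0 \le \gamma \le 1$, and $x_1 \le 4/(5-x_3)$, then $CF_1(x_1,x_2,x_3,x_4,\gamma) \ge CF_2(x_1,x_2,x_3,x_4,\gamma)$. -/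
noncomputable def CF1 (x1 x2 x3 x4 γ : ℝ) : ℝ :=
  (1 - γ)^2 * (1 - (2/3) * x1 * x2)
    + 2 * γ * (1 - γ) * (1 - x1 + (1/3) * x1 * x3)
    + γ^2 * (1 - (2/3) * x1 * x4)

noncomputable def CF2 (x1 x2 x3 x4 γ : ℝ) : ℝ :=
  (1 - γ)^2 * ((1/3) * x1 * x2)
    + γ * (1 - γ) * (x1 * (1 - (1/3) * x3))
    + γ^2 * ((1/3) * x1 * x4)

theorem stmt0 (x1 x2 x3 x4 γ : ℝ)
    (hx1 : 0 ≤ x1) (hx1' : x1 ≤ 1)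
    (hx2 : 0 ≤ x2) (hx2' : x2 ≤ 1)
    (hx3 : 0 ≤ x3) (hx3' : x3 ≤ 1)
    (hx4 : 0 ≤ x4) (hx4' : x4 ≤ 1)
    (hγ : 0 ≤ γ) (hγ' : γ ≤ 1)
    (h : x1 ≤ 4 / (5 - x3)) :
    CF1 x1 x2 x3 x4 γ ≥ CF2 x1 x2 x3 x4 γ := by
  have h5 : x1 * (5 - x3) ≤ 4 := (le_div_iff₀ (by linarith)).mp h
  have a : 0 ≤ (1 - γ)^2 * (x1 * (1 - x2)) :=
    mul_nonneg (sq_nonneg _) (mul_nonneg hx1 (by linarith))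
  have b : 0 ≤ γ^2 * (x1 * (1 - x4)) :=
    mul_nonneg (sq_nonneg _) (mul_nonneg hx1 (by linarith))
  have c : 0 ≤ (γ - 1/2)^2 * (x1 * (1 - x3)) :=
    mul_nonneg (sq_nonneg _) (mul_nonneg hx1 (by linarith))
  have e : CF1 x1 x2 x3 x4 γ - CF2 x1 x2 x3 x4 γ
      = (1 - γ)^2 * (x1 * (1 - x2)) + γ^2 * (x1 * (1 - x4))
        + (γ - 1/2)^2 * (x1 * (1 - x3)) + (4 - x1 * (5 - x3)) / 4 := by
    unfold CF1 CF2
    ring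
  linarith
end

section
/- Let $CF_1(x_1,x_2,x_3,x_4,\gamma) = (1-\gamma)^2(1-\tfrac{2}{3}x_1x_2) + 2\gamma(1-\gamma)(1-x_1+\tfrac{1}{3}x_1x_3) + \gamma^2(1-\tfrac{2}{3}x_1x_4)$ and $CF_2(x_1,x_2,x_3,x_4,\gamma) = (1-\gamma)^2\tfrac{1}{3}x_1x_2 + \gamma(1-\gamma)x_1(1-\tfrac{1}{3}x_3) + \gamma^2\tfrac{1}{3}x_1x_4$. Suppose $t_1, t_2, t_3, t_4 \ge 0$ with $t_1 \ge \log(5/4)$, and $0 \le \gamma \le 1$. Setting $x_i = e^{-t_i}$ for $i=1,2,3,4$, one has $CF_1(x_1,x_2,x_3,x_4,\gamma) \ge CF_2(x_1,x_2,x_3,x_4,\gamma)$. -/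
theorem stmt1 (t1 t2 t3 t4 γ : ℝ)
    (ht1 : 0 ≤ t1) (ht2 : 0 ≤ t2) (ht3 : 0 ≤ t3) (ht4 : 0 ≤ t4)
    (ht1' : Real.log (5/4) ≤ t1)
    (hγ : 0 ≤ γ) (hγ' : γ ≤ 1) :
    CF1 (Real.exp (-t1)) (Real.exp (-t2)) (Real.exp (-t3)) (Real.exp (-t4)) γ
      ≥ CF2 (Real.exp (-t1)) (Real.exp (-t2)) (Real.exp (-t3)) (Real.exp (-t4)) γ := by
  have ha : Real.exp (-t1) ≤ 4/5 := by
    have h := Real.exp_le_exp.mpr (neg_le_neg ht1')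
    rw [Real.exp_neg (Real.log (5/4)), Real.exp_log (by norm_num)] at h
    norm_num at h
    linarith
  have ha0 := Real.exp_pos (-t1)
  have hb : Real.exp (-t2) ≤ 1 := Real.exp_le_one_iff.mpr (by linarith)
  have hd : Real.exp (-t4) ≤ 1 := Real.exp_le_one_iff.mpr (by linarith)
  have hc0 := Real.exp_pos (-t3)
  generalize Real.exp (-t1) = a at *
  generalize Real.exp (-t2) = b at *
  generalize Real.exp (-t3) = c at *
  generalize Real.exp (-t4) = d at *
  have hg : 0 ≤ 1 - γ := by linarith
  have hd' : 0 ≤ 1 - d := by linarith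
  have hb' : 0 ≤ 1 - b := by linarith
  have h1 : 0 ≤ (1 - γ)^2 * (a * (1 - b)) := by positivity
  have h2 : 0 ≤ γ^2 * (a * (1 - d)) := by positivity
  have h3 : 0 ≤ γ * (1 - γ) * (a * c) := by positivity
  have h4 : 0 ≤ a * (γ - 1/2)^2 := by positivity
  unfold CF1 CF2
  linarith
end

section
/- Let $CF_1(x_1,x_2,x_3,x_4,\gamma) = (1-\gamma)^2(1-\tfrac{2}{3}x_1x_2) + 2\gamma(1-\gamma)(1-x_1+\tfrac{1}{3}x_1x_3) + \gamma^2(1-\tfrac{2}{3}x_1x_4)$ and $CF_2(x_1,x_2,x_3,x_4,\gamma) = (1-\gamma)^2\tfrac{1}{3}x_1x_2 + \gamma(1-\gamma)x_1(1-\tfrac{1}{3}x_3) + \gamma^2\tfrac{1}{3}x_1x_4$. If $0 \le x_1,x_2,x_3,x_4 \le 1$, $0 \le \gamma \le 1$, and $M = \max(x_2, x_4)$, then $CF_1(x_1,x_2,x_3,x_4,\gamma) - CF_2(x_1,x_2,x_3,x_4,\gamma) \ge 1 - x_1 \left(\frac{3 + 2M}{4}\right)$. -/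
theorem stmt3 (x1 x2 x3 x4 γ M : ℝ)
    (hx1 : 0 ≤ x1) (hx1' : x1 ≤ 1)
    (hx2 : 0 ≤ x2) (hx2' : x2 ≤ 1)
    (hx3 : 0 ≤ x3) (hx3' : x3 ≤ 1)
    (hx4 : 0 ≤ x4) (hx4' : x4 ≤ 1)
    (hγ : 0 ≤ γ) (hγ' : γ ≤ 1)
    (hM : M = max x2 x4) :
    CF1 x1 x2 x3 x4 γ - CF2 x1 x2 x3 x4 γ ≥ 1 - x1 * ((3 + 2 * M) / 4) := by
  have h2 : x2 ≤ M := hM ▸ le_max_left _ _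
  have h4 : x4 ≤ M := hM ▸ le_max_right _ _
  have hM1 : M ≤ 1 := hM ▸ max_le hx2' hx4'
  have hp : 0 ≤ γ * (1 - γ) := mul_nonneg hγ (by linarith)
  have a1 : 0 ≤ (1 - γ)^2 * (M - x2) := mul_nonneg (sq_nonneg _) (by linarith)
  have a2 : 0 ≤ γ^2 * (M - x4) := mul_nonneg (sq_nonneg _) (by linarith)
  have a3 : 0 ≤ γ * (1 - γ) * x3 := mul_nonneg hp hx3
  have a4 : 0 ≤ (γ - 1/2)^2 * (3 - 2 * M) := mul_nonneg (sq_nonneg _) (by linarith)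
  have key : 0 ≤ (3 + 2 * M) / 4
      - ((1 - γ)^2 * x2 + γ^2 * x4 + γ * (1 - γ) * (3 - x3)) := by
    nlinarith
  have := mul_nonneg hx1 key
  unfold CF1 CF2
  nlinarith
end

section
/- Let $CF_1(x_1,x_2,x_3,x_4,\gamma) = (1-\gamma)^2(1-\tfrac{2}{3}x_1x_2) + 2\gamma(1-\gamma)(1-x_1+\tfrac{1}{3}x_1x_3) + \gamma^2(1-\tfrac{2}{3}x_1x_4)$ and $CF_2(x_1,x_2,x_3,x_4,\gamma) = (1-\gamma)^2\tfrac{1}{3}x_1x_2 + \gamma(1-\gamma)x_1(1-\tfrac{1}{3}x_3) + \gamma^2\tfrac{1}{3}x_1x_4$. If $0 < x_1 \le 1$, $0 \le x_2,x_3,x_4 \le 1$, $0 \le \gamma \le 1$, and $\max(x_2,x_4) \le \min\left(\frac{2}{x_1} - \frac{3}{2},\ 1\right)$, then $CF_1(x_1,x_2,x_3,x_4,\gamma) \ge CF_2(x_1,x_2,x_3,x_4,\gamma)$. -/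
theorem stmt4 (x1 x2 x3 x4 γ : ℝ)
    (hx1 : 0 < x1) (hx1' : x1 ≤ 1)
    (hx2 : 0 ≤ x2) (hx2' : x2 ≤ 1)
    (hx3 : 0 ≤ x3) (hx3' : x3 ≤ 1)
    (hx4 : 0 ≤ x4) (hx4' : x4 ≤ 1)
    (hγ : 0 ≤ γ) (hγ' : γ ≤ 1)
    (hM : max x2 x4 ≤ min (2 / x1 - 3/2) 1) :
    CF1 x1 x2 x3 x4 γ ≥ CF2 x1 x2 x3 x4 γ := by
  have h0 := le_trans hM (min_le_left _ _)
  have key : ∀ y, y ≤ max x2 x4 → x1 * y ≤ x1 * max x2 x4 := fun y hy =>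
    mul_le_mul_of_nonneg_left hy hx1.le
  have h2 := key x2 (le_max_left _ _)
  have h4 := key x4 (le_max_right _ _)
  have hm1 : x1 * max x2 x4 ≤ 1 := by
    have := max_le hx2' hx4'
    have h := mul_le_mul_of_nonneg_left this hx1.le
    linarith
  have hm2 : x1 * max x2 x4 ≤ 2 - 3/2 * x1 := by
    have h := mul_le_mul_of_nonneg_left h0 hx1.le
    have e : x1 * (2 / x1 - 3/2) = 2 - 3/2 * x1 := by field_simp
    linarith
  generalize x1 * max x2 x4 = m at *
  have hab : 0 ≤ γ * (1 - γ) := mul_nonneg hγ (by linarith)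
  have p1 := mul_nonneg (sq_nonneg (1 - γ)) (sub_nonneg.2 h2)
  have p2 := mul_nonneg (sq_nonneg γ) (sub_nonneg.2 h4)
  have p3 := mul_nonneg (sq_nonneg (1 - γ - γ)) (sub_nonneg.2 hm1)
  have p4 := mul_nonneg hab (sub_nonneg.2 hm2)
  have p5 := mul_nonneg hab (mul_nonneg hx1.le hx3)
  unfold CF1 CF2
  linarith
end

section
/- Let $CF_1(x_1,x_2,x_3,x_4,\gamma) = (1-\gamma)^2(1-\tfrac{2}{3}x_1x_2) + 2\gamma(1-\gamma)(1-x_1+\tfrac{1}{3}x_1x_3) + \gamma^2(1-\tfrac{2}{3}x_1x_4)$ and $CF_2(x_1,x_2,x_3,x_4,\gamma) = (1-\gamma)^2\tfrac{1}{3}x_1x_2 + \gamma(1-\gamma)x_1(1-\tfrac{1}{3}x_3) + \gamma^2\tfrac{1}{3}x_1x_4$. If $0 \le x_1, x_3 \le 1$, $0 \le \gamma \le 1$, and $0 \le x_2, x_4 \le 1/2$, then $CF_1(x_1,x_2,x_3,x_4,\gamma) \ge CF_2(x_1,x_2,x_3,x_4,\gamma)$. -/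
theorem stmt5 (x1 x2 x3 x4 γ : ℝ)
    (hx1 : 0 ≤ x1) (hx1' : x1 ≤ 1)
    (hx3 : 0 ≤ x3) (hx3' : x3 ≤ 1)
    (hγ : 0 ≤ γ) (hγ' : γ ≤ 1)
    (hx2 : 0 ≤ x2) (hx2' : x2 ≤ 1/2)
    (hx4 : 0 ≤ x4) (hx4' : x4 ≤ 1/2) :
    CF1 x1 x2 x3 x4 γ ≥ CF2 x1 x2 x3 x4 γ := by
  have hg : 0 ≤ γ * (1 - γ) := mul_nonneg hγ (by linarith)
  have h2 : (1 - γ)^2 * x2 ≤ (1 - γ)^2 * (1/2) := mul_le_mul_of_nonneg_left hx2' (sq_nonneg _)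
  have h4 : γ^2 * x4 ≤ γ^2 * (1/2) := mul_le_mul_of_nonneg_left hx4' (sq_nonneg _)
  have h3 : 0 ≤ γ * (1 - γ) * x3 := mul_nonneg hg hx3
  have hB : (1 - γ)^2 * x2 + γ^2 * x4 + γ * (1 - γ) * (3 - x3) ≤ 1 := by
    nlinarith [sq_nonneg (2 * γ - 1)]
  have hm := mul_le_mul_of_nonneg_left hB hx1
  have e : CF1 x1 x2 x3 x4 γ - CF2 x1 x2 x3 x4 γ
      = 1 - x1 * ((1 - γ)^2 * x2 + γ^2 * x4 + γ * (1 - γ) * (3 - x3)) := by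
    unfold CF1 CF2
    ring
  linarith
end

section
/- Let $m \ge 4$ be an integer, and identify elements of $\mathrm{Fin}\, m$ with the integers $0, 1, \ldots, m-1$, with indices taken modulo $m$. For $1 \le i \le m-3$ let $A_i = \{0, 1, \ldots, i\} \subseteq \mathrm{Fin}\, m$, and for $2 \le j \le m-2$ let $B_j = \{0\} \cup \{j+1, \ldots, m-1\} \subseteq \mathrm{Fin}\, m$. Say a set $S \subseteq \mathrm{Fin}\, m$ separates $u$ and $v$ if exactly one of $u, v$ lies in $S$. Then for each $i \in \mathrm{Fin}\, m$, the number of sets among $A_1, \ldots, A_{m-3}, B_2, \ldots, B_{m-2}$ that separate $i$ and $i+1 \pmod m$ equals: $m-3$ if $i = 0$ or $i = m-1$; $1$ if $i = 1$ or $i = m-2$; and $2$ otherwise. -/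
/-- The cycle split of form (1): `A i = {0, 1, ..., i}` as a subset of `Fin m`. -/
def cycleSplitA (m i : ℕ) : Set (Fin m) := {x | (x : ℕ) ≤ i}

/-- The cycle split of form (2): `B j = {0} ∪ {j+1, ..., m-1}` as a subset of `Fin m`. -/
def cycleSplitB (m j : ℕ) : Set (Fin m) := {x | (x : ℕ) = 0 ∨ j + 1 ≤ (x : ℕ)}

/-- A set `S` separates `u` and `v` if exactly one of `u`, `v` lies in `S`. -/
def Separates {m : ℕ} (S : Set (Fin m)) (u v : Fin m) : Prop :=
  (u ∈ S ∧ v ∉ S) ∨ (u ∉ S ∧ v ∈ S)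

open scoped Classical in
theorem stmt10 (m : ℕ) [NeZero m] (hm : 4 ≤ m) (i : Fin m) :
    ((Finset.Icc 1 (m - 3)).filter (fun k => Separates (cycleSplitA m k) i (i + 1))).card
      + ((Finset.Icc 2 (m - 2)).filter (fun k => Separates (cycleSplitB m k) i (i + 1))).card
    = if (i : ℕ) = 0 ∨ (i : ℕ) = m - 1 then m - 3
      else if (i : ℕ) = 1 ∨ (i : ℕ) = m - 2 then 1
      else 2 := by
  have hi := i.isLt
  have hv : ((i : ℕ) = m - 1 ∧ ((i + 1 : Fin m) : ℕ) = 0) ∨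
      ((i : ℕ) ≠ m - 1 ∧ ((i + 1 : Fin m) : ℕ) = (i : ℕ) + 1) := by
    rw [Fin.val_add, Fin.val_one', Nat.mod_eq_of_lt (show 1 < m by omega)]
    by_cases h : (i : ℕ) = m - 1
    · left
      exact ⟨h, by rw [h, Nat.sub_add_cancel (by omega), Nat.mod_self]⟩
    · right
      exact ⟨h, Nat.mod_eq_of_lt (by omega)⟩
  have hA : (Finset.Icc 1 (m - 3)).filter (fun k => Separates (cycleSplitA m k) i (i + 1))
      = if (i : ℕ) = m - 1 then Finset.Icc 1 (m - 3)
        else if 1 ≤ (i : ℕ) ∧ (i : ℕ) ≤ m - 3 then {(i : ℕ)} else ∅ := by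
    ext k
    rw [Finset.mem_filter]
    simp only [Finset.mem_Icc, Separates, cycleSplitA, Set.mem_ofPred_eq]
    generalize ((i + 1 : Fin m) : ℕ) = v at hv
    split_ifs <;> simp only [Finset.mem_Icc, Finset.mem_singleton, Finset.notMem_empty] <;> grind
  have hB : (Finset.Icc 2 (m - 2)).filter (fun k => Separates (cycleSplitB m k) i (i + 1))
      = if (i : ℕ) = 0 then Finset.Icc 2 (m - 2)
        else if 2 ≤ (i : ℕ) ∧ (i : ℕ) ≤ m - 2 then {(i : ℕ)} else ∅ := by
    ext k
    rw [Finset.mem_filter]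
    simp only [Finset.mem_Icc, Separates, cycleSplitB, Set.mem_ofPred_eq]
    generalize ((i + 1 : Fin m) : ℕ) = v at hv
    split_ifs <;> simp only [Finset.mem_Icc, Finset.mem_singleton, Finset.notMem_empty] <;> grind
  rw [hA, hB]
  split_ifs <;> simp only [Nat.card_Icc, Finset.card_singleton, Finset.card_empty] <;> omega
end
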